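/- arXiv:1602.01418 — 2 statements merged into one kernel-verified Lean document; each statement's English description precedes it below -/
import Mathlib

section
/- Let N = 2n ≥ 2, index the standard basis of ℂ^N by I_N = {-n,…,-1,1,…,n}, and set θ_{ij} = sign(i)·sign(j) (symplectic case). Let P = Σ_{i,j∈I_N} E_{ij}⊗E_{ji}, Q = Σ_{i,j∈I_N} θ_{ij} E_{ij}⊗E_{-i,-j} ∈ End(ℂ^N⊗ℂ^N), κ = N/2 + 1, and R(u) = I − P/u + Q/(u−κ). Then for all u,v ∈ ℂ with u, v, u+v ∉ {0, κ}, the quantum Yang–Baxter equation with spectral parameters holds on (ℂ^N)^{⊗3}: R₁₂(u) R₁₃(u+v) R₂₃(v) = R₂₃(v) R₁₃(u+v) R₁₂(u), where R_{ab}(u) acts as R(u) on tensor factors a and b and as the identity on the remaining factor. -/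
open Matrix Kronecker Finset

noncomputable section

/-- The index set `I_N` as a subtype of `ℤ` determined by a finite set `S ⊆ ℤ`. -/
abbrev Idx (S : Finset ℤ) : Type := {i : ℤ // i ∈ S}

/-- The matrix unit `E_{ab}` of `End(ℂ^N)` (zero if `a` or `b` is not in the index set). -/
def Emat (S : Finset ℤ) (a b : ℤ) : Matrix (Idx S) (Idx S) ℂ :=
  fun p q => if ((p : ℤ) = a ∧ (q : ℤ) = b) then 1 else 0

/-- The permutation operator `P = Σ_{i,j} E_{ij} ⊗ E_{ji}` on `ℂ^N ⊗ ℂ^N`. -/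
def Pmat (S : Finset ℤ) : Matrix (Idx S × Idx S) (Idx S × Idx S) ℂ :=
  ∑ i ∈ S, ∑ j ∈ S, Emat S i j ⊗ₖ Emat S j i

/-- The operator `Q = Σ_{i,j} θ_{ij} E_{ij} ⊗ E_{-i,-j}` on `ℂ^N ⊗ ℂ^N`. -/
def Qmat (S : Finset ℤ) (θ : ℤ → ℤ → ℂ) : Matrix (Idx S × Idx S) (Idx S × Idx S) ℂ :=
  ∑ i ∈ S, ∑ j ∈ S, θ i j • (Emat S i j ⊗ₖ Emat S (-i) (-j))

/-- The R-matrix `R(u) = I - P/u + Q/(u - κ)` of types B, C, D. -/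
def Rmat (S : Finset ℤ) (θ : ℤ → ℤ → ℂ) (κ u : ℂ) :
    Matrix (Idx S × Idx S) (Idx S × Idx S) ℂ :=
  1 - u⁻¹ • Pmat S + (u - κ)⁻¹ • Qmat S θ

/-- `θ_{ij} = 1` (orthogonal case). -/
def θorth : ℤ → ℤ → ℂ := fun _ _ => 1

/-- `θ_{ij} = sign(i)·sign(j)` (symplectic case). -/
def θsymp : ℤ → ℤ → ℂ := fun i j =>
  (if 0 < i then (1 : ℂ) else -1) * (if 0 < j then (1 : ℂ) else -1)

/-- `R_{12}`: act on tensor factors 1 and 2 of the triple tensor product. -/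
def lift12 (S : Finset ℤ) (M : Matrix (Idx S × Idx S) (Idx S × Idx S) ℂ) :
    Matrix (Idx S × Idx S × Idx S) (Idx S × Idx S × Idx S) ℂ :=
  fun p q => M (p.1, p.2.1) (q.1, q.2.1) * (if p.2.2 = q.2.2 then 1 else 0)

/-- `R_{13}`: act on tensor factors 1 and 3 of the triple tensor product. -/
def lift13 (S : Finset ℤ) (M : Matrix (Idx S × Idx S) (Idx S × Idx S) ℂ) :
    Matrix (Idx S × Idx S × Idx S) (Idx S × Idx S × Idx S) ℂ :=
  fun p q => M (p.1, p.2.2) (q.1, q.2.2) * (if p.2.1 = q.2.1 then 1 else 0)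

/-- `R_{23}`: act on tensor factors 2 and 3 of the triple tensor product. -/
def lift23 (S : Finset ℤ) (M : Matrix (Idx S × Idx S) (Idx S × Idx S) ℂ) :
    Matrix (Idx S × Idx S × Idx S) (Idx S × Idx S × Idx S) ℂ :=
  fun p q => M (p.2.1, p.2.2) (q.2.1, q.2.2) * (if p.1 = q.1 then 1 else 0)

/-- Generators `p a`, `q a` of the three-strand Brauer algebra with loop parameter `δ`, in its
symplectic form: `p a` and `q a` act on the two strands other than `a`. -/
structure SymplecticBrauer {A : Type*} [Ring A] [Algebra ℂ A] (δ : ℂ) (p q : Fin 3 → A) :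
    Prop where
  p_mul_p_self : ∀ a, p a * p a = 1
  p_mul_q_self : ∀ a, p a * q a = -q a
  q_mul_p_self : ∀ a, q a * p a = -q a
  q_mul_q_self : ∀ a, q a * q a = δ • q a
  p_mul_p : ∀ a b c, a ≠ b → b ≠ c → a ≠ c → p a * p b = p b * p c
  q_mul_p : ∀ a b c, a ≠ b → b ≠ c → a ≠ c → q a * p c = q a * q b
  p_mul_q : ∀ a b c, a ≠ b → b ≠ c → a ≠ c → p c * q b = q a * q b

namespace SymplecticBrauer

variable {A : Type*} [Ring A] [Algebra ℂ A] {δ : ℂ} {p q : Fin 3 → A}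

lemma q_mul_q_mul_q (h : SymplecticBrauer δ p q) {a b c : Fin 3} (hab : a ≠ b) (hbc : b ≠ c)
    (hac : a ≠ c) : q a * (q b * q c) = -(q a * q c) := by
  rw [← mul_assoc, ← h.q_mul_p a b c hab hbc hac, mul_assoc, h.p_mul_q_self, mul_neg]

lemma q_mul_q_mul_q_self (h : SymplecticBrauer δ p q) {a b c : Fin 3} (hab : a ≠ b) (hbc : b ≠ c)
    (hac : a ≠ c) : q a * (q b * q a) = q a := by
  rw [← h.p_mul_q b a c hab.symm hac hbc, ← mul_assoc, h.q_mul_p a b c hab hbc hac,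
    ← h.q_mul_p a b c hab hbc hac, mul_assoc, h.p_mul_q b a c hab.symm hac hbc,
    ← h.q_mul_p b a c hab.symm hac hbc, ← mul_assoc, ← h.q_mul_p a b c hab hbc hac, mul_assoc,
    h.p_mul_p_self, mul_one]

/-- The Yang–Baxter equation in the Brauer algebra with loop parameter `δ = 2 * κ - 2`. -/
theorem yang_baxter (h : SymplecticBrauer δ p q) {κ u v : ℂ} (hδ : δ = 2 * κ - 2)
    (hu0 : u ≠ 0) (huκ : u ≠ κ) (hv0 : v ≠ 0) (hvκ : v ≠ κ)
    (huv0 : u + v ≠ 0) (huvκ : u + v ≠ κ) :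
    (1 - u⁻¹ • p 2 + (u - κ)⁻¹ • q 2) * (1 - (u + v)⁻¹ • p 1 + (u + v - κ)⁻¹ • q 1) *
        (1 - v⁻¹ • p 0 + (v - κ)⁻¹ • q 0) =
      (1 - v⁻¹ • p 0 + (v - κ)⁻¹ • q 0) * (1 - (u + v)⁻¹ • p 1 + (u + v - κ)⁻¹ • q 1) *
        (1 - u⁻¹ • p 2 + (u - κ)⁻¹ • q 2) := by
  have hp1 : p 2 * p 1 = p 0 * p 2 := (h.p_mul_p 0 2 1 (by decide) (by decide) (by decide)).symm
  have hp2 : p 1 * p 0 = p 0 * p 2 := h.p_mul_p 1 0 2 (by decide) (by decide) (by decide)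
  have hp3 : p 0 * p 1 = p 2 * p 0 := (h.p_mul_p 2 0 1 (by decide) (by decide) (by decide)).symm
  have hp4 : p 1 * p 2 = p 2 * p 0 := h.p_mul_p 1 2 0 (by decide) (by decide) (by decide)
  have hp5 : p 2 * (p 0 * p 2) = p 1 := by
    rw [← hp1, ← mul_assoc, h.p_mul_p_self, one_mul]
  have hp6 : p 0 * (p 2 * p 0) = p 1 := by
    rw [← hp3, ← mul_assoc, h.p_mul_p_self, one_mul]
  have hu : u - κ ≠ 0 := sub_ne_zero.2 huκ
  have hv : v - κ ≠ 0 := sub_ne_zero.2 hvκ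
  have huv : u + v - κ ≠ 0 := sub_ne_zero.2 huvκ
  have reassoc {x y z : A} (hxy : x * y = z) (t : A) : x * (y * t) = z * t := by
    rw [← mul_assoc, hxy]
  have a01 := h.q_mul_p 0 1 2 (by decide) (by decide) (by decide)
  have a02 := h.q_mul_p 0 2 1 (by decide) (by decide) (by decide)
  have a10 := h.q_mul_p 1 0 2 (by decide) (by decide) (by decide)
  have a12 := h.q_mul_p 1 2 0 (by decide) (by decide) (by decide)
  have a20 := h.q_mul_p 2 0 1 (by decide) (by decide) (by decide)
  have a21 := h.q_mul_p 2 1 0 (by decide) (by decide) (by decide)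
  have b01 := h.p_mul_q 0 1 2 (by decide) (by decide) (by decide)
  have b02 := h.p_mul_q 0 2 1 (by decide) (by decide) (by decide)
  have b10 := h.p_mul_q 1 0 2 (by decide) (by decide) (by decide)
  have b12 := h.p_mul_q 1 2 0 (by decide) (by decide) (by decide)
  have b20 := h.p_mul_q 2 0 1 (by decide) (by decide) (by decide)
  have b21 := h.p_mul_q 2 1 0 (by decide) (by decide) (by decide)
  have c012 := h.q_mul_q_mul_q (a := 0) (b := 1) (c := 2) (by decide) (by decide) (by decide)
  have c210 := h.q_mul_q_mul_q (a := 2) (b := 1) (c := 0) (by decide) (by decide) (by decide)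
  have d01 := h.q_mul_q_mul_q_self (a := 0) (b := 1) (c := 2) (by decide) (by decide) (by decide)
  have d21 := h.q_mul_q_mul_q_self (a := 2) (b := 1) (c := 0) (by decide) (by decide) (by decide)
  simp only [mul_add, add_mul, mul_sub, sub_mul, mul_one, one_mul, smul_mul_assoc, mul_smul_comm,
    mul_assoc, mul_neg, smul_neg, h.q_mul_p_self, h.q_mul_q_self,
    hp1, hp2, hp3, hp4, hp5, hp6, a01, a02, a10, a12, a20, a21, b01, b02, b10, b12, b20, b21,
    reassoc b01, reassoc b21, c012, c210, d01, d21]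
  subst hδ
  match_scalars <;> field_simp <;> ring

end SymplecticBrauer

/-- The sign of an integer, with the value `-1` at `0`. -/
def sgn (i : ℤ) : ℂ := if 0 < i then 1 else -1

lemma sgn_mul_self (i : ℤ) : sgn i * sgn i = 1 := by
  unfold sgn; split_ifs <;> norm_num

lemma sgn_neg {i : ℤ} (hi : i ≠ 0) : sgn (-i) = -sgn i := by
  unfold sgn
  rcases lt_or_gt_of_ne hi with h | h
  · rw [if_pos (by omega), if_neg (by omega), neg_neg]
  · rw [if_neg (by omega), if_pos h]

section Action

variable {S : Finset ℤ}

lemma Pmat_apply (a b c d : Idx S) :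
    Pmat S (a, b) (c, d) = if a = d ∧ b = c then 1 else 0 := by
  simp only [Pmat, Matrix.sum_apply, kroneckerMap_apply, Emat, Subtype.ext_iff]
  rw [Finset.sum_eq_single (a : ℤ), Finset.sum_eq_single (c : ℤ)]
  · simp only [and_true, mul_ite, mul_one, mul_zero, ← ite_and]
    exact if_congr (by grind) rfl rfl
  · grind
  · exact fun h => absurd c.2 h
  · exact fun i _ hi => Finset.sum_eq_zero fun j _ => by grind
  · exact fun h => absurd a.2 h

lemma Qmat_apply (ν : Idx S → Idx S) (hν : ∀ i, (ν i : ℤ) = -i) (a b c d : Idx S) :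
    Qmat S θsymp (a, b) (c, d) = if b = ν a ∧ d = ν c then sgn a * sgn c else 0 := by
  simp only [Qmat, Matrix.sum_apply, Matrix.smul_apply, kroneckerMap_apply, Emat, Subtype.ext_iff,
    hν]
  rw [Finset.sum_eq_single (a : ℤ), Finset.sum_eq_single (c : ℤ)]
  · simp [θsymp, sgn]
  · exact fun j _ hj => by simp [hj.symm]
  · exact fun h => absurd c.2 h
  · exact fun i _ hi => Finset.sum_eq_zero fun j _ => by simp [hi.symm]
  · exact fun h => absurd a.2 h

/-- The lift of `M` to the two tensor factors other than the given one. -/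
def liftOmit (M : Matrix (Idx S × Idx S) (Idx S × Idx S) ℂ) :
    Fin 3 → Matrix (Idx S × Idx S × Idx S) (Idx S × Idx S × Idx S) ℂ :=
  ![lift23 S M, lift13 S M, lift12 S M]

lemma lift12_mulVec (M : Matrix (Idx S × Idx S) (Idx S × Idx S) ℂ) (f : Idx S × Idx S × Idx S → ℂ)
    (a b c : Idx S) :
    (lift12 S M *ᵥ f) (a, b, c) = ∑ x, ∑ y, M (a, b) (x, y) * f (x, y, c) := by
  simp [lift12, mulVec, dotProduct, Fintype.sum_prod_type]

lemma lift13_mulVec (M : Matrix (Idx S × Idx S) (Idx S × Idx S) ℂ) (f : Idx S × Idx S × Idx S → ℂ)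
    (a b c : Idx S) :
    (lift13 S M *ᵥ f) (a, b, c) = ∑ x, ∑ y, M (a, c) (x, y) * f (x, b, y) := by
  simp only [lift13, mulVec, dotProduct, Fintype.sum_prod_type]
  refine Finset.sum_congr rfl fun x _ => ?_
  rw [Finset.sum_comm]
  simp

lemma lift23_mulVec (M : Matrix (Idx S × Idx S) (Idx S × Idx S) ℂ) (f : Idx S × Idx S × Idx S → ℂ)
    (a b c : Idx S) :
    (lift23 S M *ᵥ f) (a, b, c) = ∑ x, ∑ y, M (b, c) (x, y) * f (a, x, y) := by
  simp only [lift23, mulVec, dotProduct, Fintype.sum_prod_type]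
  rw [Finset.sum_eq_single a] <;> simp +contextual [eq_comm]

lemma sum_Pmat (g : Idx S → Idx S → ℂ) (a b : Idx S) :
    ∑ x, ∑ y, Pmat S (a, b) (x, y) * g x y = g b a := by
  simp [Pmat_apply, ite_and]

lemma sum_Qmat (ν : Idx S → Idx S) (hν : ∀ i, (ν i : ℤ) = -i) (g : Idx S → Idx S → ℂ)
    (a b : Idx S) :
    ∑ x, ∑ y, Qmat S θsymp (a, b) (x, y) * g x y =
      if b = ν a then sgn a * ∑ x : Idx S, sgn x * g x (ν x) else 0 := by
  by_cases h : b = ν a <;>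
    simp [Qmat_apply ν hν, h, Finset.mul_sum, mul_assoc]

lemma lift12_Pmat_mulVec (f : Idx S × Idx S × Idx S → ℂ) (a b c : Idx S) :
    (lift12 S (Pmat S) *ᵥ f) (a, b, c) = f (b, a, c) := by
  rw [lift12_mulVec, sum_Pmat]

lemma lift13_Pmat_mulVec (f : Idx S × Idx S × Idx S → ℂ) (a b c : Idx S) :
    (lift13 S (Pmat S) *ᵥ f) (a, b, c) = f (c, b, a) := by
  rw [lift13_mulVec, sum_Pmat]

lemma lift23_Pmat_mulVec (f : Idx S × Idx S × Idx S → ℂ) (a b c : Idx S) :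
    (lift23 S (Pmat S) *ᵥ f) (a, b, c) = f (a, c, b) := by
  rw [lift23_mulVec, sum_Pmat]

lemma lift12_Qmat_mulVec (ν : Idx S → Idx S) (hν : ∀ i, (ν i : ℤ) = -i)
    (f : Idx S × Idx S × Idx S → ℂ) (a b c : Idx S) :
    (lift12 S (Qmat S θsymp) *ᵥ f) (a, b, c) =
      if b = ν a then sgn a * ∑ x : Idx S, sgn x * f (x, ν x, c) else 0 := by
  rw [lift12_mulVec, sum_Qmat ν hν fun x y => f (x, y, c)]

lemma lift13_Qmat_mulVec (ν : Idx S → Idx S) (hν : ∀ i, (ν i : ℤ) = -i)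
    (f : Idx S × Idx S × Idx S → ℂ) (a b c : Idx S) :
    (lift13 S (Qmat S θsymp) *ᵥ f) (a, b, c) =
      if c = ν a then sgn a * ∑ x : Idx S, sgn x * f (x, b, ν x) else 0 := by
  rw [lift13_mulVec, sum_Qmat ν hν fun x y => f (x, b, y)]

lemma lift23_Qmat_mulVec (ν : Idx S → Idx S) (hν : ∀ i, (ν i : ℤ) = -i)
    (f : Idx S × Idx S × Idx S → ℂ) (a b c : Idx S) :
    (lift23 S (Qmat S θsymp) *ᵥ f) (a, b, c) =
      if c = ν b then sgn b * ∑ x : Idx S, sgn x * f (a, x, ν x) else 0 := by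
  rw [lift23_mulVec, sum_Qmat ν hν fun x y => f (a, x, y)]

lemma lift12_Rmat (θ : ℤ → ℤ → ℂ) (κ u : ℂ) :
    lift12 S (Rmat S θ κ u) =
      1 - u⁻¹ • lift12 S (Pmat S) + (u - κ)⁻¹ • lift12 S (Qmat S θ) := by
  ext ⟨a, b, c⟩ ⟨x, y, z⟩
  simp only [lift12, Rmat, Matrix.add_apply, Matrix.sub_apply, Matrix.smul_apply, Matrix.one_apply,
    smul_eq_mul, Prod.mk.injEq]
  grind

lemma lift13_Rmat (θ : ℤ → ℤ → ℂ) (κ u : ℂ) :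
    lift13 S (Rmat S θ κ u) =
      1 - u⁻¹ • lift13 S (Pmat S) + (u - κ)⁻¹ • lift13 S (Qmat S θ) := by
  ext ⟨a, b, c⟩ ⟨x, y, z⟩
  simp only [lift13, Rmat, Matrix.add_apply, Matrix.sub_apply, Matrix.smul_apply, Matrix.one_apply,
    smul_eq_mul, Prod.mk.injEq]
  grind

lemma lift23_Rmat (θ : ℤ → ℤ → ℂ) (κ u : ℂ) :
    lift23 S (Rmat S θ κ u) =
      1 - u⁻¹ • lift23 S (Pmat S) + (u - κ)⁻¹ • lift23 S (Qmat S θ) := by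
  ext ⟨a, b, c⟩ ⟨x, y, z⟩
  simp only [lift23, Rmat, Matrix.add_apply, Matrix.sub_apply, Matrix.smul_apply, Matrix.one_apply,
    smul_eq_mul, Prod.mk.injEq]
  grind

lemma symplecticBrauer_liftOmit (h0 : (0 : ℤ) ∉ S) (ν : Idx S → Idx S)
    (hν : ∀ i, (ν i : ℤ) = -i) :
    SymplecticBrauer (S.card : ℂ) (liftOmit (Pmat S)) (liftOmit (Qmat S θsymp)) := by
  have hνν (i : Idx S) : ν (ν i) = i := Subtype.ext (by simp [hν])
  have hsgn (i : Idx S) : sgn (ν i) = -sgn i := by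
    rw [hν, sgn_neg fun h => h0 (h ▸ i.2)]
  have hss (i : Idx S) (z : ℂ) : sgn i * (sgn i * z) = z := by
    rw [← mul_assoc, sgn_mul_self, one_mul]
  have hν_eq (i j : Idx S) : i = ν j ↔ j = ν i :=
    ⟨fun h => by rw [h, hνν], fun h => by rw [h, hνν]⟩
  have hsum_ite (i : Idx S) (g : Idx S → ℂ) :
      ∑ x : Idx S, (if i = ν x then g x else 0) = g (ν i) := by
    simp [hν_eq i, -Finset.univ_eq_attach]
  have hνinj (i j : Idx S) : ν i = ν j ↔ i = j :=
    (Function.LeftInverse.injective hνν).eq_iff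
  have hsum (g : Idx S → Idx S → ℂ) :
      ∑ x : Idx S, sgn x * g (ν x) x = -∑ x : Idx S, sgn x * g x (ν x) := by
    rw [← Finset.sum_neg_distrib]
    exact Finset.sum_nbij' ν ν (by simp) (by simp) (by simp [hνν]) (by simp [hνν])
      (by simp [hνν, hsgn])
  have hsum12 (f : Idx S × Idx S × Idx S → ℂ) (c : Idx S) := hsum fun x y => f (x, y, c)
  have hsum13 (f : Idx S × Idx S × Idx S → ℂ) (c : Idx S) := hsum fun x y => f (x, c, y)
  have hsum23 (f : Idx S × Idx S × Idx S → ℂ) (c : Idx S) := hsum fun x y => f (c, x, y)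
  have ext_mulVec {M M' : Matrix (Idx S × Idx S × Idx S) (Idx S × Idx S × Idx S) ℂ}
      (h : ∀ f a b c, (M *ᵥ f) (a, b, c) = (M' *ᵥ f) (a, b, c)) : M = M' :=
    Matrix.ext_iff_mulVec.2 fun f => funext fun x => h f x.1 x.2.1 x.2.2
  have hQ12 := lift12_Qmat_mulVec ν hν
  have hQ13 := lift13_Qmat_mulVec ν hν
  have hQ23 := lift23_Qmat_mulVec ν hν
  constructor
  case p_mul_p_self =>
    intro a
    fin_cases a <;> refine ext_mulVec fun f x y z => ?_ <;>
      simp [liftOmit, ← mulVec_mulVec, lift12_Pmat_mulVec, lift13_Pmat_mulVec,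
      lift23_Pmat_mulVec]
  case p_mul_q_self =>
    intro a
    fin_cases a <;> refine ext_mulVec fun f x y z => ?_ <;>
      simp [liftOmit, ← mulVec_mulVec, neg_mulVec, lift12_Pmat_mulVec, lift13_Pmat_mulVec,
      lift23_Pmat_mulVec, hQ12, hQ13, hQ23, -Finset.univ_eq_attach] <;> grind
  case q_mul_p_self =>
    intro a
    fin_cases a <;> refine ext_mulVec fun f x y z => ?_ <;>
      simp [liftOmit, ← mulVec_mulVec, neg_mulVec, lift12_Pmat_mulVec, lift13_Pmat_mulVec,
      lift23_Pmat_mulVec, hQ12, hQ13, hQ23,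
      hsum12, hsum13, hsum23, -Finset.univ_eq_attach] <;> grind
  case q_mul_q_self =>
    intro a
    fin_cases a <;> refine ext_mulVec fun f x y z => ?_ <;>
      simp [liftOmit, ← mulVec_mulVec, smul_mulVec, hQ12, hQ13, hQ23, hss,
      -Finset.univ_eq_attach] <;> grind
  case p_mul_p =>
    intro a b c hab hbc hac
    fin_cases a <;> fin_cases b <;> fin_cases c <;>
      try first | exact absurd rfl hab | exact absurd rfl hbc | exact absurd rfl hac
    all_goals refine ext_mulVec fun f x y z => ?_
    all_goals simp [liftOmit, ← mulVec_mulVec, lift12_Pmat_mulVec, lift13_Pmat_mulVec,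
      lift23_Pmat_mulVec]
  case q_mul_p =>
    intro a b c hab hbc hac
    fin_cases a <;> fin_cases b <;> fin_cases c <;>
      try first | exact absurd rfl hab | exact absurd rfl hbc | exact absurd rfl hac
    all_goals refine ext_mulVec fun f x y z => ?_
    all_goals simp [liftOmit, ← mulVec_mulVec, lift12_Pmat_mulVec, lift13_Pmat_mulVec,
      lift23_Pmat_mulVec, hQ12, hQ13, hQ23, hνν, hsum12, hsum23,
      hsgn, hss, hsum_ite, hνinj, -Finset.univ_eq_attach]
  case p_mul_q =>
    intro a b c hab hbc hac
    fin_cases a <;> fin_cases b <;> fin_cases c <;>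
      try first | exact absurd rfl hab | exact absurd rfl hbc | exact absurd rfl hac
    all_goals refine ext_mulVec fun f x y z => ?_
    all_goals simp [liftOmit, ← mulVec_mulVec, lift12_Pmat_mulVec, lift13_Pmat_mulVec,
      lift23_Pmat_mulVec, hQ12, hQ13, hQ23, hνν, hsgn, hss, hsum_ite,
      hνinj, -Finset.univ_eq_attach] <;> grind

end Action

/-- the quantum Yang–Baxter equation for the symplectic R-matrix
`R(u) = I - P/u + Q/(u-κ)`, `κ = N/2 + 1`, with index set `{-n,…,-1,1,…,n}`. -/
theorem yang_baxter_symplectic (N n : ℕ) (hN : 2 ≤ N) (hpar : N = 2 * n)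
    (S : Finset ℤ)
    (hS : S = (Finset.Icc (-(n : ℤ)) (n : ℤ)).erase 0)
    (κ : ℂ) (hκ : κ = (N : ℂ) / 2 + 1)
    (u v : ℂ) (hu0 : u ≠ 0) (huκ : u ≠ κ) (hv0 : v ≠ 0) (hvκ : v ≠ κ)
    (huv0 : u + v ≠ 0) (huvκ : u + v ≠ κ) :
    lift12 S (Rmat S θsymp κ u) * lift13 S (Rmat S θsymp κ (u + v)) *
        lift23 S (Rmat S θsymp κ v) =
      lift23 S (Rmat S θsymp κ v) * lift13 S (Rmat S θsymp κ (u + v)) *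
        lift12 S (Rmat S θsymp κ u) := by
  have h0 : (0 : ℤ) ∉ S := by simp [hS]
  have hneg (i : ℤ) (hi : i ∈ S) : -i ∈ S := by
    simp only [hS, Finset.mem_erase, Finset.mem_Icc] at hi ⊢
    omega
  have hcard : (S.card : ℂ) = 2 * κ - 2 := by
    have : S.card = N := by
      rw [hS, Finset.card_erase_of_mem (by simp), Int.card_Icc]
      omega
    rw [this, hκ]
    ring
  simp only [lift12_Rmat, lift13_Rmat, lift23_Rmat]
  exact (symplecticBrauer_liftOmit h0 (fun i => ⟨-i, hneg i i.2⟩) fun _ => rfl).yang_baxter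
    hcard hu0 huκ hv0 hvκ huv0 huvκ
end
end

section
/- Let N = 2n ≥ 2 with indices I_N = {-n,…,-1,1,…,n}, θ_{ij} = 1 for all i,j, P = Σ E_{ij}⊗E_{ji}, Q = Σ θ_{ij} E_{ij}⊗E_{-i,-j}, κ = N/2 − 1, and R(u) = I − P/u + Q/(u−κ) (the orthogonal R-matrix). Let 𝒢 = Σ_{i=1}^{n} (E_{ii} − E_{-i,-i}) (the matrix of the symmetric pair of type DIII, (so_N, gl_{N/2})). Then the constant K-matrix K(u) = 𝒢 is a solution of the reflection equation: for all u,v ∈ ℂ with u−v, u+v ∉ {0, κ}, R(u−v) 𝒢₁ R(u+v) 𝒢₂ = 𝒢₂ R(u+v) 𝒢₁ R(u−v) in End(ℂ^N⊗ℂ^N), where 𝒢₁ = 𝒢⊗I and 𝒢₂ = I⊗𝒢. -/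
open Matrix Kronecker Finset

noncomputable section

/-- The algebraic relations under which a constant `K` satisfying `g₁ = K₁`, `g₂ = K₂` solves the
reflection equation, for arbitrary coefficients of the two R-matrices. -/
theorem reflection_of_relations {A : Type*} [Ring A] [Algebra ℂ A] {P Q g₁ g₂ : A}
    (hP : P * P = 1) (hPQ : P * Q = Q) (hQP : Q * P = Q) (hPg : P * g₁ = g₂ * P)
    (h₁ : g₁ * g₁ = 1) (h₂ : g₂ * g₂ = 1) (hg : g₁ * g₂ = g₂ * g₁)
    (hgQ : g₁ * Q = -(g₂ * Q)) (hQg : Q * g₁ = -(Q * g₂)) (a b c d : ℂ) :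
    (1 - a • P + c • Q) * g₁ * (1 - b • P + d • Q) * g₂ =
      g₂ * (1 - b • P + d • Q) * g₁ * (1 - a • P + c • Q) := by
  have hPg' : P * g₂ = g₁ * P := by
    calc P * g₂ = P * (g₂ * P) * P := by simp only [mul_assoc, hP, mul_one]
      _ = g₁ * P := by rw [← hPg, ← mul_assoc, hP, one_mul]
  have hQ₀ : Q * g₁ * Q = 0 := by
    have h : Q * g₁ * Q = Q * g₂ * Q := by
      calc Q * g₁ * Q = Q * (P * g₁) * Q := by rw [← mul_assoc, hQP]
        _ = Q * g₂ * Q := by rw [hPg, mul_assoc, mul_assoc, hPQ, mul_assoc]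
    have h' : Q * g₁ * Q = -(Q * g₁ * Q) := by
      conv_lhs => rw [hQg, neg_mul, ← h]
    have h2 : (2 : ℂ) • (Q * g₁ * Q) = 0 := by
      rw [two_smul]; nth_rewrite 1 [h']; exact neg_add_cancel _
    exact (smul_eq_zero_iff_right two_ne_zero).1 h2
  set M := g₁ * (1 - b • P + d • Q) * g₂ with hM
  have hM₁ : M = g₁ * g₂ - b • P + d • (g₁ * Q * g₂) := by
    have : g₁ * P * g₂ = P := by rw [mul_assoc, hPg', ← mul_assoc, h₁, one_mul]
    simp only [hM, mul_add, mul_sub, add_mul, sub_mul, mul_one, mul_smul_comm, smul_mul_assoc, this]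
  have hM₂ : g₂ * (1 - b • P + d • Q) * g₁ = M := by
    have hX : g₂ * Q * g₁ = g₁ * Q * g₂ := by
      rw [hgQ, mul_assoc g₂ Q g₁, hQg, neg_mul, mul_neg, mul_assoc]
    have : g₂ * P * g₁ = P := by rw [mul_assoc, hPg, ← mul_assoc, h₂, one_mul]
    simp only [hM₁, mul_add, mul_sub, add_mul, sub_mul, mul_one, mul_smul_comm, smul_mul_assoc,
      this, hX, hg]
  have hPM : P * M = M * P := by
    have e₁ : P * (g₁ * g₂) = g₁ * g₂ * P := by
      rw [← mul_assoc, hPg, mul_assoc, hPg', ← mul_assoc, hg]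
    have e₂ : P * (g₁ * Q * g₂) = g₁ * Q * g₂ * P := by
      calc P * (g₁ * Q * g₂) = P * g₁ * Q * g₂ := by simp only [mul_assoc]
        _ = g₂ * Q * g₂ := by rw [hPg, mul_assoc g₂, hPQ]
        _ = g₁ * Q * g₁ := by rw [hgQ, neg_mul, mul_assoc, mul_assoc, hQg, mul_neg, neg_neg]
        _ = g₁ * (Q * P) * g₁ := by rw [hQP]
        _ = g₁ * Q * g₂ * P := by simp only [mul_assoc, hPg]
    simp only [hM₁, mul_add, mul_sub, add_mul, sub_mul, mul_smul_comm, smul_mul_assoc, e₁, e₂]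
  have hQM : Q * M = M * Q := by
    have e₁ : Q * (g₁ * g₂) = g₁ * g₂ * Q := by
      calc Q * (g₁ * g₂) = -Q := by rw [← mul_assoc, hQg, neg_mul, mul_assoc, h₂, mul_one]
        _ = g₁ * g₂ * Q := by rw [hg, mul_assoc, hgQ, mul_neg, ← mul_assoc, h₂, one_mul]
    have e₂ : Q * (g₁ * Q * g₂) = 0 := by rw [← mul_assoc, ← mul_assoc, hQ₀, zero_mul]
    have e₃ : g₁ * Q * g₂ * Q = 0 := by
      have : Q * g₂ = -(Q * g₁) := by rw [hQg, neg_neg]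
      rw [mul_assoc g₁, this, mul_assoc, neg_mul, hQ₀, neg_zero, mul_zero]
    simp only [hM₁, mul_add, mul_sub, add_mul, sub_mul, mul_smul_comm, smul_mul_assoc, e₁, e₂, e₃,
      hPQ, hQP]
  calc _ = (1 - a • P + c • Q) * M := by simp only [hM, mul_assoc]
    _ = M * (1 - a • P + c • Q) := by
      simp only [mul_add, mul_sub, add_mul, sub_mul, mul_smul_comm, smul_mul_assoc, hPM, hQM,
        one_mul, mul_one]
    _ = _ := by rw [hM₂]

theorem Pmat_apply_s3 (S : Finset ℤ) (p q : Idx S × Idx S) :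
    Pmat S p q = if p.swap = q then 1 else 0 := by
  obtain ⟨⟨p₁, h₁⟩, p₂, h₂⟩ := p
  obtain ⟨⟨q₁, h₃⟩, q₂, h₄⟩ := q
  simp [Pmat, Emat, Matrix.sum_apply, ite_and]
  grind

theorem Qmat_θorth_apply (S : Finset ℤ) (p q : Idx S × Idx S) :
    Qmat S θorth p q =
      if (p.2 : ℤ) = -p.1 ∧ (q.2 : ℤ) = -q.1 then 1 else 0 := by
  obtain ⟨⟨p₁, h₁⟩, p₂, h₂⟩ := p
  obtain ⟨⟨q₁, h₃⟩, q₂, h₄⟩ := q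
  simp [Qmat, θorth, Emat, Matrix.sum_apply, ite_and, ← neg_eq_iff_eq_neg]
  grind

theorem Pmat_mul_apply (S : Finset ℤ) (M : Matrix (Idx S × Idx S) (Idx S × Idx S) ℂ)
    (p q : Idx S × Idx S) : (Pmat S * M) p q = M p.swap q := by
  simp [Matrix.mul_apply, Pmat_apply_s3]

theorem mul_Pmat_apply (S : Finset ℤ) (M : Matrix (Idx S × Idx S) (Idx S × Idx S) ℂ)
    (p q : Idx S × Idx S) : (M * Pmat S) p q = M p q.swap := by
  simp [Matrix.mul_apply, Pmat_apply_s3, Prod.swap_eq_iff_eq_swap]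

/-- The matrix `𝒢` is diagonal, with the sign of the index as entries. -/
theorem sum_Emat_sub_Emat_neg (n : ℕ) (S : Finset ℤ)
    (hS : S = (Finset.Icc (-(n : ℤ)) (n : ℤ)).erase 0) :
    ∑ i ∈ Finset.Icc (1 : ℤ) (n : ℤ), (Emat S i i - Emat S (-i) (-i)) =
      Matrix.diagonal fun i : Idx S => if 0 < (i : ℤ) then (1 : ℂ) else -1 := by
  ext ⟨p, hp⟩ ⟨q, hq⟩
  have hp' : p ≠ 0 ∧ -(n : ℤ) ≤ p ∧ p ≤ n := by simpa [hS] using hp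
  simp only [Matrix.sum_apply, Matrix.sub_apply, Emat, Matrix.diagonal_apply,
    Finset.sum_sub_distrib, ite_and, Subtype.mk.injEq, ← neg_eq_iff_eq_neg, Finset.sum_ite_eq,
    Finset.mem_Icc]
  grind

/-- the constant K-matrix `K(u) = 𝒢 = Σ_{i=1}^{n} (E_{ii} - E_{-i,-i})`
of type DIII solves the reflection equation for the orthogonal R-matrix (`κ = N/2 - 1`). -/
theorem reflection_DIII (N n : ℕ) (hN : 2 ≤ N) (hpar : N = 2 * n)
    (S : Finset ℤ) (hS : S = (Finset.Icc (-(n : ℤ)) (n : ℤ)).erase 0)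
    (κ : ℂ) (hκ : κ = (N : ℂ) / 2 - 1)
    (G : Matrix (Idx S) (Idx S) ℂ)
    (hG : G = ∑ i ∈ Finset.Icc (1 : ℤ) (n : ℤ), (Emat S i i - Emat S (-i) (-i)))
    (u v : ℂ) (h1 : u - v ≠ 0) (h2 : u - v ≠ κ) (h3 : u + v ≠ 0) (h4 : u + v ≠ κ) :
    Rmat S θorth κ (u - v) * (G ⊗ₖ (1 : Matrix (Idx S) (Idx S) ℂ)) *
        Rmat S θorth κ (u + v) * ((1 : Matrix (Idx S) (Idx S) ℂ) ⊗ₖ G) =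
      ((1 : Matrix (Idx S) (Idx S) ℂ) ⊗ₖ G) * Rmat S θorth κ (u + v) *
        (G ⊗ₖ (1 : Matrix (Idx S) (Idx S) ℂ)) * Rmat S θorth κ (u - v) := by
  have hS₀ (i : Idx S) : (i : ℤ) ≠ 0 := by
    have := i.2
    simp only [hS, Finset.mem_erase] at this
    exact this.1
  rw [hG, sum_Emat_sub_Emat_neg n S hS, ← Matrix.diagonal_one,
    Matrix.diagonal_kronecker_diagonal, Matrix.diagonal_kronecker_diagonal]
  apply reflection_of_relations
  · ext p q
    rw [Pmat_mul_apply, Pmat_apply_s3, Prod.swap_swap, Matrix.one_apply]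
  · ext p q
    rw [Pmat_mul_apply, Qmat_θorth_apply, Qmat_θorth_apply]
    grind [Prod.fst_swap, Prod.snd_swap]
  · ext p q
    rw [mul_Pmat_apply, Qmat_θorth_apply, Qmat_θorth_apply]
    grind [Prod.fst_swap, Prod.snd_swap]
  · ext p q
    rw [Pmat_mul_apply, mul_Pmat_apply, Matrix.diagonal_apply, Matrix.diagonal_apply]
    grind
  · rw [Matrix.diagonal_mul_diagonal, ← Matrix.diagonal_one]
    grind
  · rw [Matrix.diagonal_mul_diagonal, ← Matrix.diagonal_one]
    grind
  · simp [mul_comm]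
  · ext p q
    have := hS₀ p.1
    simp only [Matrix.neg_apply, Matrix.diagonal_mul, Qmat_θorth_apply]
    grind
  · ext p q
    have := hS₀ q.1
    simp only [Matrix.neg_apply, Matrix.mul_diagonal, Qmat_θorth_apply]
    grind
end
end
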